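/- Every injective holomorphic function h : ℂ → ℂ is an affine map: there exist α, β ∈ ℂ with α ≠ 0 such that h(z) = α·z + β for all z ∈ ℂ. In particular, every holomorphic automorphism of ℂ is affine, and there is no bijective holomorphic map from ℂ onto a proper open subset of ℂ. -/

import Mathlib

open Metric in
/-- An entire function of at most linear growth is affine. -/
theorem Differentiable.exists_eq_add_mul_sub_of_norm_le {f : ℂ → ℂ} (hf : Differentiable ℂ f)
    (c : ℂ) {A : ℝ} (hA : ∀ z, 1 ≤ ‖z - c‖ → ‖f z‖ ≤ A * ‖z - c‖) :
    ∃ b : ℂ, ∀ z, f z = f c + b * (z - c) := by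
  have hd : Differentiable ℂ (dslope f c) := by
    rw [← differentiableOn_univ, Complex.differentiableOn_dslope Filter.univ_mem]
    exact hf.differentiableOn
  obtain ⟨B, hB⟩ := (isCompact_closedBall c 1).exists_bound_of_continuousOn
    hd.continuous.continuousOn
  have hbdd : Bornology.IsBounded (Set.range (dslope f c)) := by
    refine isBounded_iff_forall_norm_le.2 ⟨max B (A + ‖f c‖), ?_⟩
    rintro _ ⟨z, rfl⟩
    rcases le_or_gt ‖z - c‖ 1 with hz | hz
    · exact (hB z (by rwa [mem_closedBall, dist_eq_norm])).trans (le_max_left _ _)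
    · refine le_trans ?_ (le_max_right _ _)
      have hne : z ≠ c := by
        rintro rfl
        simp [zero_lt_one.not_gt] at hz
      rw [dslope_of_ne _ hne, slope_def_field, norm_div, div_le_iff₀ (by linarith)]
      have h₁ := hA z hz.le
      have h₂ := norm_sub_le (f z) (f c)
      nlinarith [norm_nonneg (f c)]
  obtain ⟨b, hb⟩ := hd.exists_const_forall_eq_of_bounded hbdd
  refine ⟨b, fun z ↦ ?_⟩
  have := sub_smul_dslope f c z
  rw [hb, smul_eq_mul] at this
  linear_combination -this

open Metric in
/-- An injective entire function stays away from `h c` outside the unit ball around `c`. -/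
theorem Differentiable.exists_le_norm_sub_of_injective {h : ℂ → ℂ} (hdiff : Differentiable ℂ h)
    (hinj : Function.Injective h) (c : ℂ) :
    ∃ ε > 0, ∀ z, 1 ≤ ‖z - c‖ → ε ≤ ‖h z - h c‖ := by
  have hopen : IsOpenMap h := by
    refine (AnalyticOnNhd.is_constant_or_isOpenMap
      (fun z _ ↦ hdiff.analyticAt z)).resolve_left ?_
    rintro ⟨w, hw⟩
    exact zero_ne_one (hinj ((hw 0).trans (hw 1).symm))
  obtain ⟨ε, hε, hsub⟩ := isOpen_iff.1 (hopen _ (isOpen_ball (x := c) (ε := 1))) (h c)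
    (Set.mem_image_of_mem h (mem_ball_self one_pos))
  refine ⟨ε, hε, fun z hz ↦ ?_⟩
  by_contra! hlt
  obtain ⟨w, hw, hwz⟩ := hsub (show h z ∈ ball (h c) ε by rwa [mem_ball, dist_eq_norm])
  rw [hinj hwz, mem_ball, dist_eq_norm] at hw
  linarith

/-- Every injective entire function `h : ℂ → ℂ` is affine: `h(z) = α·z + β`
with `α ≠ 0`. In particular every holomorphic automorphism of ℂ is affine. -/
theorem injective_entire_is_affine (h : ℂ → ℂ)
    (hdiff : Differentiable ℂ h) (hinj : Function.Injective h) :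
    ∃ α β : ℂ, α ≠ 0 ∧ ∀ z : ℂ, h z = α * z + β := by
  obtain ⟨c, hc⟩ : ∃ c, deriv h c ≠ 0 := by
    by_contra! h0
    exact zero_ne_one (hinj (is_const_of_deriv_eq_zero hdiff h0 0 1))
  obtain ⟨ε, hε, hle⟩ := hdiff.exists_le_norm_sub_of_injective hinj c
  have hd : Differentiable ℂ (dslope h c) := by
    rw [← differentiableOn_univ, Complex.differentiableOn_dslope Filter.univ_mem]
    exact hdiff.differentiableOn
  have hmul (z : ℂ) : (z - c) * dslope h c z = h z - h c := by
    simpa using sub_smul_dslope h c z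
  have hne (z : ℂ) : dslope h c z ≠ 0 := by
    rcases eq_or_ne z c with rfl | hz
    · rwa [dslope_same]
    · intro h0
      have := hmul z
      rw [h0, mul_zero] at this
      exact hz (hinj (sub_eq_zero.1 this.symm))
  obtain ⟨b, hb⟩ := (hd.fun_inv hne).exists_eq_add_mul_sub_of_norm_le c (A := ε⁻¹) fun z hz ↦ by
    have h₁ := hle z hz
    have h₂ : 0 < ‖dslope h c z‖ := norm_pos_iff.2 (hne z)
    rw [← hmul, norm_mul] at h₁
    rw [norm_inv, inv_mul_eq_div, le_div_iff₀ hε, inv_mul_le_iff₀ h₂]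
    linarith
  have hb0 : b = 0 := by
    by_contra hb0
    refine inv_ne_zero (hne (c - (dslope h c c)⁻¹ / b)) ?_
    rw [hb]
    field_simp
    ring
  refine ⟨dslope h c c, h c - dslope h c c * c, hne c, fun z ↦ ?_⟩
  have hz : dslope h c z = dslope h c c := inv_injective (by simpa [hb0] using hb z)
  have := hmul z
  rw [hz] at this
  linear_combination -this
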